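/- Under Assumption 1, let p ∈ ℝ^n with p ≥ 0 satisfy p = T(p), and let K̂ ∈ 𝒦 be such that the spectral radius of A + BK̂ is strictly less than 1 (so that I − (A + BK̂) is invertible). Then s ≤ p ≤ (I − (A + BK̂))^{−T}(s + K̂^T r) entrywise; that is, the lower heuristic h_low = s and the upper heuristic h_up = (I − (A + BK̂))^{−T}(s + K̂^T r) satisfy h_low^T x ≤ p^T x ≤ h_up^T x for every x ≥ 0. -/

import Mathlib

open Matrix Finset

/-- `minZero v` is the minimum of the entries of `v` and of the scalar `0`. -/
noncomputable def minZero {k : ℕ} (v : Fin k → ℝ) : ℝ :=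
  (insert (0 : ℝ) (Finset.image v Finset.univ)).min' (Finset.insert_nonempty _ _)

/-- The Bellman operator `T(p) = s + Aᵀ p + Σ_i min{r_i + B_iᵀ p, 0} E_i`. -/
noncomputable def bellman {n : ℕ} {m : Fin n → ℕ}
    (A : Matrix (Fin n) (Fin n) ℝ) (B : ∀ i, Matrix (Fin n) (Fin (m i)) ℝ)
    (s : Fin n → ℝ) (r : ∀ i, Fin (m i) → ℝ) (E : Matrix (Fin n) (Fin n) ℝ)
    (p : Fin n → ℝ) : Fin n → ℝ :=
  fun j => s j + (Aᵀ *ᵥ p) j +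
    ∑ i, minZero (fun l => r i l + ((B i)ᵀ *ᵥ p) l) * E i j

/-- Membership in the set 𝒦 of blockwise nonnegative feedback matrices with
full (`1ᵀ K_i = E_iᵀ`) or zero (`1ᵀ K_i = 0`) actuation in each block. -/
def memK {n : ℕ} {m : Fin n → ℕ} (E : Matrix (Fin n) (Fin n) ℝ)
    (K : ∀ i, Matrix (Fin (m i)) (Fin n) ℝ) : Prop :=
  ∀ i, (∀ l j, 0 ≤ K i l j) ∧
    ((∀ j, ∑ l, K i l j = E i j) ∨ (∀ j, ∑ l, K i l j = 0))

/-- Assumption 1: `(A + BK) x ≥ 0` for every `K ∈ 𝒦` and every `x ≥ 0`. -/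
def assumption1 {n : ℕ} {m : Fin n → ℕ}
    (A : Matrix (Fin n) (Fin n) ℝ) (B : ∀ i, Matrix (Fin n) (Fin (m i)) ℝ)
    (E : Matrix (Fin n) (Fin n) ℝ) : Prop :=
  ∀ K : ∀ i, Matrix (Fin (m i)) (Fin n) ℝ, memK E K →
    ∀ x : Fin n → ℝ, 0 ≤ x → 0 ≤ (A + ∑ i, B i * K i) *ᵥ x

/-- The constraint set `U(x) = {u : u ≥ 0, 1ᵀ u_i ≤ E_iᵀ x for all i}`. -/
def inputSet {n : ℕ} {m : Fin n → ℕ} (E : Matrix (Fin n) (Fin n) ℝ)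
    (x : Fin n → ℝ) : Set (∀ i, Fin (m i) → ℝ) :=
  {u | ∀ i, (∀ l, 0 ≤ u i l) ∧ (∑ l, u i l) ≤ ∑ j, E i j * x j}

/-- An admissible trajectory from `x0`: `x(0) = x0`, `u(t) ∈ U(x(t))` and
`x(t+1) = A x(t) + B u(t)`. -/
def admissible {n : ℕ} {m : Fin n → ℕ}
    (A : Matrix (Fin n) (Fin n) ℝ) (B : ∀ i, Matrix (Fin n) (Fin (m i)) ℝ)
    (E : Matrix (Fin n) (Fin n) ℝ) (x0 : Fin n → ℝ)
    (x : ℕ → Fin n → ℝ) (u : ℕ → ∀ i, Fin (m i) → ℝ) : Prop :=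
  x 0 = x0 ∧ ∀ t, u t ∈ inputSet E (x t) ∧
    x (t + 1) = A *ᵥ x t + ∑ i, (B i) *ᵥ (u t i)

/-- The state trajectory generated by a control sequence `u` from `x0`. -/
noncomputable def traj {n : ℕ} {m : Fin n → ℕ}
    (A : Matrix (Fin n) (Fin n) ℝ) (B : ∀ i, Matrix (Fin n) (Fin (m i)) ℝ)
    (x0 : Fin n → ℝ) (u : ℕ → ∀ i, Fin (m i) → ℝ) : ℕ → Fin n → ℝ
  | 0 => x0
  | t + 1 => A *ᵥ traj A B x0 u t + ∑ i, (B i) *ᵥ (u t i)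

/-- Total cost `Σ_{t=0}^∞ [sᵀ x(t) + rᵀ u(t)] ∈ [0,∞]` of a trajectory. -/
noncomputable def trajCost {n : ℕ} {m : Fin n → ℕ}
    (s : Fin n → ℝ) (r : ∀ i, Fin (m i) → ℝ)
    (x : ℕ → Fin n → ℝ) (u : ℕ → ∀ i, Fin (m i) → ℝ) : ENNReal :=
  ∑' t, ENNReal.ofReal ((∑ j, s j * x t j) + ∑ i, ∑ l, r i l * u t i l)

/-- Optimal value `V(x0)`: infimum of the total cost over admissible trajectories. -/
noncomputable def optValue {n : ℕ} {m : Fin n → ℕ}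
    (A : Matrix (Fin n) (Fin n) ℝ) (B : ∀ i, Matrix (Fin n) (Fin (m i)) ℝ)
    (E : Matrix (Fin n) (Fin n) ℝ) (s : Fin n → ℝ) (r : ∀ i, Fin (m i) → ℝ)
    (x0 : Fin n → ℝ) : ENNReal :=
  ⨅ (x : ℕ → Fin n → ℝ) (u : ℕ → ∀ i, Fin (m i) → ℝ)
    (_ : admissible A B E x0 x u), trajCost s r x u

/-- The spectral radius of `M` is strictly less than `1`. -/
def schurStable {n : ℕ} (M : Matrix (Fin n) (Fin n) ℝ) : Prop :=
  ∀ μ ∈ spectrum ℂ (M.map Complex.ofReal), ‖μ‖ < 1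

theorem minZero_nonpos {k : ℕ} (v : Fin k → ℝ) : minZero v ≤ 0 :=
  Finset.min'_le _ _ (Finset.mem_insert_self _ _)

theorem minZero_le {k : ℕ} (v : Fin k → ℝ) (l : Fin k) : minZero v ≤ v l :=
  Finset.min'_le _ _ (Finset.mem_insert_of_mem (Finset.mem_image_of_mem v (Finset.mem_univ l)))

theorem minZero_eq_zero_or_exists {k : ℕ} (v : Fin k → ℝ) :
    minZero v = 0 ∨ ∃ l, v l = minZero v := by
  have h := Finset.min'_mem (insert (0 : ℝ) (Finset.image v Finset.univ))
    (Finset.insert_nonempty _ _)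
  rw [Finset.mem_insert, Finset.mem_image] at h
  exact h.imp id fun ⟨l, _, hl⟩ => ⟨l, hl⟩

/-- In a complex Banach algebra, the powers of an element whose spectrum lies in the open unit disc
tend to zero. -/
theorem tendsto_pow_zero_of_spectrum_norm_lt_one {R : Type*} [NormedRing R] [NormedAlgebra ℂ R]
    [CompleteSpace R] [Nontrivial R] (a : R) (h : ∀ μ ∈ spectrum ℂ a, ‖μ‖ < 1) :
    Filter.Tendsto (fun k : ℕ => a ^ k) Filter.atTop (nhds 0) := by
  have hρ : spectralRadius ℂ a < ((1 : NNReal) : ENNReal) :=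
    spectrum.spectralRadius_lt_of_forall_lt a fun z hz => by exact_mod_cast h z hz
  obtain ⟨c, hρc, hc⟩ := ENNReal.lt_iff_exists_nnreal_btwn.1 hρ
  have hc1 : c < 1 := by exact_mod_cast hc
  have hev := (spectrum.pow_nnnorm_pow_one_div_tendsto_nhds_spectralRadius a).eventually_lt_const hρc
  refine squeeze_zero_norm' ?_
    (tendsto_pow_atTop_nhds_zero_of_lt_one c.coe_nonneg (by exact_mod_cast hc1))
  filter_upwards [hev, Filter.eventually_ge_atTop 1] with k hk hk1
  have hk0 : (0 : ℝ) < k := by exact_mod_cast hk1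
  have h1 : (‖a ^ k‖₊ : ENNReal) ≤ (c : ENNReal) ^ (k : ℝ) := by
    rw [one_div] at hk
    exact (ENNReal.rpow_inv_le_iff hk0).1 hk.le
  rw [ENNReal.rpow_natCast] at h1
  exact_mod_cast h1

theorem schurStable.tendsto_pow_apply {n : ℕ} {M : Matrix (Fin n) (Fin n) ℝ} (h : schurStable M)
    (i j : Fin n) : Filter.Tendsto (fun k : ℕ => (M ^ k) i j) Filter.atTop (nhds 0) := by
  let _ : NormedRing (Matrix (Fin n) (Fin n) ℂ) := Matrix.linftyOpNormedRing
  let _ : NormedAlgebra ℂ (Matrix (Fin n) (Fin n) ℂ) := Matrix.linftyOpNormedAlgebra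
  have : Nonempty (Fin n) := ⟨i⟩
  have : CompleteSpace (Matrix (Fin n) (Fin n) ℂ) := FiniteDimensional.complete ℂ _
  have ht := tendsto_pow_zero_of_spectrum_norm_lt_one (M.map Complex.ofReal) h
  have hcont := (Matrix.entryLinearMap ℂ ℂ i j :
    Matrix (Fin n) (Fin n) ℂ →ₗ[ℂ] ℂ).continuous_of_finiteDimensional
  have hre := (Complex.continuous_re.tendsto _).comp ((hcont.tendsto 0).comp ht)
  rw [map_zero, Complex.zero_re] at hre
  refine hre.congr fun k => ?_
  have hpow : (M.map Complex.ofReal) ^ k = (M ^ k).map Complex.ofReal :=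
    (map_pow (Complex.ofRealHom.mapMatrix (m := Fin n)) M k).symm
  simp [hpow]

theorem schurStable.isUnit_one_sub {n : ℕ} {M : Matrix (Fin n) (Fin n) ℝ} (h : schurStable M) :
    IsUnit (1 - M) := by
  have h1 : (1 : ℂ) ∉ spectrum ℂ (M.map Complex.ofReal) := fun hmem => by
    simpa using h 1 hmem
  rw [spectrum.notMem_iff, map_one, Matrix.isUnit_iff_isUnit_det] at h1
  have hmap : 1 - M.map Complex.ofReal = Complex.ofRealHom.mapMatrix (1 - M) := by
    rw [map_sub, map_one]; rfl
  rw [hmap, ← RingHom.map_det, isUnit_iff_ne_zero] at h1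
  rw [Matrix.isUnit_iff_isUnit_det, isUnit_iff_ne_zero]
  exact fun h0 => h1 (by rw [h0, map_zero])

theorem transpose_mulVec_apply {k n : ℕ} (M : Matrix (Fin k) (Fin n) ℝ) (v : Fin k → ℝ)
    (j : Fin n) : (Mᵀ *ᵥ v) j = ∑ i, M i j * v i := rfl

/-- A subinvariant vector `d ≤ Mᵀ d` of a nonnegative Schur stable matrix is nonpositive. -/
theorem schurStable.nonpos_of_le_transpose_mulVec {n : ℕ} {M : Matrix (Fin n) (Fin n) ℝ}
    (h : schurStable M) (hM : ∀ i j, 0 ≤ M i j) {d : Fin n → ℝ} (hd : d ≤ Mᵀ *ᵥ d) : d ≤ 0 := by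
  have hiter : ∀ k : ℕ, d ≤ (M ^ k)ᵀ *ᵥ d := by
    intro k
    induction k with
    | zero => simp
    | succ k ih =>
      refine hd.trans fun j => ?_
      rw [pow_succ, Matrix.transpose_mul, ← Matrix.mulVec_mulVec]
      rw [transpose_mulVec_apply, transpose_mulVec_apply]
      exact Finset.sum_le_sum fun i _ => mul_le_mul_of_nonneg_left (ih i) (hM i j)
  intro j
  have ht : Filter.Tendsto (fun k : ℕ => ((M ^ k)ᵀ *ᵥ d) j) Filter.atTop (nhds 0) := by
    have := tendsto_finsetSum Finset.univ fun i _ =>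
      (h.tendsto_pow_apply i j).mul_const (d i)
    simpa [Matrix.mulVec, dotProduct] using this
  exact ge_of_tendsto' ht fun k => hiter k j

/-- The closed-loop cost expression `s + Kᵀ r + (A + B K)ᵀ p`, written blockwise. -/
theorem closedLoop_apply {n : ℕ} {m : Fin n → ℕ}
    (A : Matrix (Fin n) (Fin n) ℝ) (B : ∀ i, Matrix (Fin n) (Fin (m i)) ℝ)
    (s : Fin n → ℝ) (r : ∀ i, Fin (m i) → ℝ) (K : ∀ i, Matrix (Fin (m i)) (Fin n) ℝ)
    (p : Fin n → ℝ) (j : Fin n) :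
    ((s + ∑ i, (K i)ᵀ *ᵥ r i) + (A + ∑ i, B i * K i)ᵀ *ᵥ p) j =
      s j + (Aᵀ *ᵥ p) j + ∑ i, ∑ l, (r i l + ((B i)ᵀ *ᵥ p) l) * K i l j := by
  have h1 : (A + ∑ i, B i * K i)ᵀ *ᵥ p = Aᵀ *ᵥ p + ∑ i, (K i)ᵀ *ᵥ ((B i)ᵀ *ᵥ p) := by
    simp only [Matrix.transpose_add, Matrix.transpose_sum, Matrix.transpose_mul, Matrix.add_mulVec,
      Matrix.sum_mulVec, Matrix.mulVec_mulVec]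
  have h2 : ∀ i, ∑ l, (r i l + ((B i)ᵀ *ᵥ p) l) * K i l j =
      ((K i)ᵀ *ᵥ r i) j + ((K i)ᵀ *ᵥ ((B i)ᵀ *ᵥ p)) j := by
    intro i
    rw [← Pi.add_apply, ← Matrix.mulVec_add]
    exact Finset.sum_congr rfl fun l _ => mul_comm _ _
  rw [h1, Finset.sum_congr rfl fun i _ => h2 i, Finset.sum_add_distrib]
  simp only [Pi.add_apply, Finset.sum_apply]
  ring

/-- The Bellman operator is bounded above by the cost of any admissible feedback. -/
theorem bellman_le_closedLoop {n : ℕ} {m : Fin n → ℕ}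
    (A : Matrix (Fin n) (Fin n) ℝ) (B : ∀ i, Matrix (Fin n) (Fin (m i)) ℝ)
    (s : Fin n → ℝ) (r : ∀ i, Fin (m i) → ℝ) {E : Matrix (Fin n) (Fin n) ℝ}
    (hE : ∀ i j, 0 ≤ E i j) {K : ∀ i, Matrix (Fin (m i)) (Fin n) ℝ} (hK : memK E K)
    (p : Fin n → ℝ) :
    bellman A B s r E p ≤ (s + ∑ i, (K i)ᵀ *ᵥ r i) + (A + ∑ i, B i * K i)ᵀ *ᵥ p := by
  intro j
  rw [closedLoop_apply, bellman]
  refine add_le_add_right (Finset.sum_le_sum fun i _ => ?_) _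
  set v : Fin (m i) → ℝ := fun l => r i l + ((B i)ᵀ *ᵥ p) l
  obtain ⟨hnonneg, hsum⟩ := hK i
  have hle : minZero v * ∑ l, K i l j ≤ ∑ l, v l * K i l j := by
    rw [Finset.mul_sum]
    exact Finset.sum_le_sum fun l _ => mul_le_mul_of_nonneg_right (minZero_le v l) (hnonneg l j)
  rcases hsum with hsum | hsum
  · rwa [hsum j] at hle
  · rw [hsum j, mul_zero] at hle
    exact (mul_nonpos_of_nonpos_of_nonneg (minZero_nonpos v) (hE i j)).trans hle

/-- The Bellman operator is attained by some admissible feedback. -/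
theorem exists_bellman_eq_closedLoop {n : ℕ} {m : Fin n → ℕ}
    (A : Matrix (Fin n) (Fin n) ℝ) (B : ∀ i, Matrix (Fin n) (Fin (m i)) ℝ)
    (s : Fin n → ℝ) (r : ∀ i, Fin (m i) → ℝ) {E : Matrix (Fin n) (Fin n) ℝ}
    (hE : ∀ i j, 0 ≤ E i j) (p : Fin n → ℝ) :
    ∃ K : ∀ i, Matrix (Fin (m i)) (Fin n) ℝ, memK E K ∧
      bellman A B s r E p = (s + ∑ i, (K i)ᵀ *ᵥ r i) + (A + ∑ i, B i * K i)ᵀ *ᵥ p := by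
  have hblock : ∀ i, ∃ Ki : Matrix (Fin (m i)) (Fin n) ℝ,
      ((∀ l j, 0 ≤ Ki l j) ∧ ((∀ j, ∑ l, Ki l j = E i j) ∨ (∀ j, ∑ l, Ki l j = 0))) ∧
      ∀ j, minZero (fun l => r i l + ((B i)ᵀ *ᵥ p) l) * E i j =
        ∑ l, (r i l + ((B i)ᵀ *ᵥ p) l) * Ki l j := by
    intro i
    rcases minZero_eq_zero_or_exists (fun l => r i l + ((B i)ᵀ *ᵥ p) l) with h0 | ⟨l₀, hl₀⟩
    · exact ⟨0, by simp, by simp [h0]⟩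
    · refine ⟨fun l j => if l = l₀ then E i j else 0, ⟨fun l j => ?_, Or.inl fun j => by simp⟩,
        fun j => by simp [← hl₀]⟩
      dsimp only
      split_ifs
      exacts [hE i j, le_rfl]
  choose K hK hKeq using hblock
  refine ⟨K, hK, funext fun j => ?_⟩
  rw [closedLoop_apply, bellman, Finset.sum_congr rfl fun i _ => hKeq i j]

theorem assumption1.closedLoop_nonneg {n : ℕ} {m : Fin n → ℕ}
    {A : Matrix (Fin n) (Fin n) ℝ} {B : ∀ i, Matrix (Fin n) (Fin (m i)) ℝ}
    {E : Matrix (Fin n) (Fin n) ℝ} (h : assumption1 A B E)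
    {K : ∀ i, Matrix (Fin (m i)) (Fin n) ℝ} (hK : memK E K) (i j : Fin n) :
    0 ≤ (A + ∑ i, B i * K i) i j := by
  have := h K hK (Pi.single j 1) (Pi.single_nonneg.2 zero_le_one) i
  rwa [Matrix.mulVec_single_one] at this

/-- under Assumption 1, for a nonnegative fixed point `p = T(p)` and a
Schur-stabilizing `K̂ ∈ 𝒦`, the heuristics `h_low = s` and
`h_up = (I − (A + BK̂))^{-T}(s + K̂ᵀ r)` satisfy `s ≤ p ≤ h_up`, hence
`h_lowᵀ x ≤ pᵀ x ≤ h_upᵀ x` for every `x ≥ 0`. -/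
theorem stmt_12 {n : ℕ} {m : Fin n → ℕ}
    (A : Matrix (Fin n) (Fin n) ℝ) (B : ∀ i, Matrix (Fin n) (Fin (m i)) ℝ)
    (s : Fin n → ℝ) (r : ∀ i, Fin (m i) → ℝ) (E : Matrix (Fin n) (Fin n) ℝ)
    (hs : ∀ j, 0 < s j) (hr : ∀ i l, 0 ≤ r i l)
    (hE : ∀ i j, 0 ≤ E i j) (hEinv : IsUnit E.det)
    (hA1 : assumption1 A B E)
    (p : Fin n → ℝ) (hp : 0 ≤ p) (hfix : p = bellman A B s r E p)
    (K : ∀ i, Matrix (Fin (m i)) (Fin n) ℝ) (hK : memK E K)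
    (hschur : schurStable (A + ∑ i, B i * K i)) :
    s ≤ p ∧
    p ≤ ((1 - (A + ∑ i, B i * K i))⁻¹)ᵀ *ᵥ (s + ∑ i, (K i)ᵀ *ᵥ (r i)) ∧
    ∀ x : Fin n → ℝ, 0 ≤ x →
      (∑ j, s j * x j) ≤ (∑ j, p j * x j) ∧
      (∑ j, p j * x j) ≤
        ∑ j, (((1 - (A + ∑ i, B i * K i))⁻¹)ᵀ *ᵥ
          (s + ∑ i, (K i)ᵀ *ᵥ (r i))) j * x j := by
  set M := A + ∑ i, B i * K i with hMdef
  set c := s + ∑ i, (K i)ᵀ *ᵥ (r i) with hc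
  have hlow : s ≤ p := by
    obtain ⟨L, hL, hLeq⟩ := exists_bellman_eq_closedLoop A B s r hE p
    intro j
    have hpj := congrFun (hfix.trans hLeq) j
    have h1 : 0 ≤ (∑ i, (L i)ᵀ *ᵥ r i) j := by
      rw [Finset.sum_apply]
      refine Finset.sum_nonneg fun i _ => ?_
      rw [transpose_mulVec_apply]
      exact Finset.sum_nonneg fun l _ => mul_nonneg ((hL i).1 l j) (hr i l)
    have h2 : 0 ≤ ((A + ∑ i, B i * L i)ᵀ *ᵥ p) j := by
      rw [transpose_mulVec_apply]
      exact Finset.sum_nonneg fun i _ => mul_nonneg (hA1.closedLoop_nonneg hL i j) (hp i)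
    rw [Pi.add_apply, Pi.add_apply] at hpj
    linarith
  have hup : p ≤ ((1 - M)⁻¹)ᵀ *ᵥ c := by
    set q := ((1 - M)⁻¹)ᵀ *ᵥ c with hq
    have hfixq : q = c + Mᵀ *ᵥ q := by
      have hdet := (Matrix.isUnit_iff_isUnit_det _).1 hschur.isUnit_one_sub
      have h1 : (1 - M)ᵀ *ᵥ q = c := by
        rw [hq, Matrix.mulVec_mulVec, ← Matrix.transpose_mul, Matrix.nonsing_inv_mul _ hdet,
          Matrix.transpose_one, Matrix.one_mulVec]
      rw [Matrix.transpose_sub, Matrix.transpose_one, Matrix.sub_mulVec, Matrix.one_mulVec] at h1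
      exact sub_eq_iff_eq_add.1 h1
    have hple : p ≤ c + Mᵀ *ᵥ p := hfix.trans_le (bellman_le_closedLoop A B s r hE hK p)
    have hsub : p - q ≤ Mᵀ *ᵥ (p - q) := by
      rw [Matrix.mulVec_sub]
      calc p - q ≤ (c + Mᵀ *ᵥ p) - q := sub_le_sub_right hple q
        _ = (c + Mᵀ *ᵥ p) - (c + Mᵀ *ᵥ q) := by rw [← hfixq]
        _ = Mᵀ *ᵥ p - Mᵀ *ᵥ q := add_sub_add_left_eq_sub _ _ _
    exact sub_nonpos.1 (hschur.nonpos_of_le_transpose_mulVec (hA1.closedLoop_nonneg hK) hsub)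
  exact ⟨hlow, hup, fun x hx =>
    ⟨Finset.sum_le_sum fun j _ => mul_le_mul_of_nonneg_right (hlow j) (hx j),
      Finset.sum_le_sum fun j _ => mul_le_mul_of_nonneg_right (hup j) (hx j)⟩⟩
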